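/- arXiv:1303.5609 — 2 statements merged into one kernel-verified Lean document; each statement's English description precedes it below -/
import Mathlib

section
/- Let x, y ∈ Fⁿ be linearly independent and set X = x·yᵀ − y·xᵀ. Then Φ^σ · X^σ · Φ · X = 0 if and only if either span{x,y} is totally isotropic for φ, or span{x,y} contains a nonzero vector w with Φ·w = 0 (i.e. span{x,y} ∩ Rad(φ) ≠ 0). -/
open Matrix

/-- Applying a ring isomorphism entrywise commutes with `mulVec`. -/
theorem map_mulVec_ringEquiv {F m n : Type*} [Field F] [Fintype n] (σ : F ≃+* F)
    (A : Matrix m n F) (w : n → F) :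
    A.map σ *ᵥ (fun j => σ (w j)) = fun i => σ ((A *ᵥ w) i) := by
  ext i
  simp [mulVec, dotProduct, map_sum]

/-- The product `A (a bᵀ - b aᵀ) B (x yᵀ - y xᵀ)` as a difference of two rank-one matrices. -/
theorem mul_sub_vecMulVec_mul_mul_sub_vecMulVec {F n : Type*} [Field F] [Fintype n]
    (A B : Matrix n n F) (a b x y : n → F) :
    A * (vecMulVec a b - vecMulVec b a) * B * (vecMulVec x y - vecMulVec y x) =
      vecMulVec ((b ⬝ᵥ B *ᵥ x) • A *ᵥ a - (a ⬝ᵥ B *ᵥ x) • A *ᵥ b) y -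
        vecMulVec ((b ⬝ᵥ B *ᵥ y) • A *ᵥ a - (a ⬝ᵥ B *ᵥ y) • A *ᵥ b) x := by
  have key (c d : n → F) :
      (A * (vecMulVec a b - vecMulVec b a) * B) * vecMulVec c d =
        vecMulVec ((b ⬝ᵥ B *ᵥ c) • A *ᵥ a - (a ⬝ᵥ B *ᵥ c) • A *ᵥ b) d := by
    rw [mul_vecMulVec, ← mulVec_mulVec, ← mulVec_mulVec, sub_mulVec, vecMulVec_mulVec,
      vecMulVec_mulVec, mulVec_sub]
    simp [mulVec_smul]
  rw [mul_sub, key, key]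

/-- If `x` and `y` are linearly independent, `p yᵀ = q xᵀ` only when `p = q = 0`. -/
theorem vecMulVec_sub_vecMulVec_eq_zero_iff {F m n : Type*} [Field F] {x y : n → F}
    (hxy : LinearIndependent F ![x, y]) (p q : m → F) :
    vecMulVec p y - vecMulVec q x = 0 ↔ p = 0 ∧ q = 0 := by
  refine ⟨fun h => ?_, by rintro ⟨rfl, rfl⟩; simp⟩
  have key (i : m) : -q i = 0 ∧ p i = 0 := by
    refine LinearIndependent.pair_iff.1 hxy _ _ ?_
    ext j
    have := congrFun (congrFun h i) j
    simp only [Matrix.sub_apply, vecMulVec_apply, Matrix.zero_apply] at this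
    simp only [Pi.add_apply, Pi.smul_apply, smul_eq_mul, Pi.zero_apply]
    linear_combination this
  exact ⟨funext fun i => (key i).2, funext fun i => neg_eq_zero.1 (key i).1⟩

/-- Vectors on a common line `A u + B v = 0` satisfy every relation `c u = d v` whose
coefficients satisfy `A d + B c = 0`. -/
theorem smul_sub_smul_eq_zero_of_relation {F V : Type*} [Field F] [AddCommGroup V] [Module F V]
    {A B c d : F} {u v : V} (hAB : A ≠ 0 ∨ B ≠ 0) (huv : A • u + B • v = 0)
    (hcd : A * d + B * c = 0) : c • u - d • v = 0 := by
  rcases hAB with h | h <;> refine (smul_eq_zero.1 ?_).resolve_left h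
  · linear_combination (norm := module) c • huv - hcd • v
  · linear_combination (norm := module) -d • huv + hcd • u

/-- Corollary 3.5: `Φ^σ X^σ Φ X = O` iff either `⟨x,y⟩` is totally isotropic
for `φ` or `⟨x,y⟩ ∩ Rad(φ) ≠ 0`. -/
theorem stmt_4 (F : Type*) [Field F] (n : ℕ) (hn : 4 ≤ n)
    (σ : F ≃+* F) (hσ : ∀ t, σ (σ t) = t)
    (ε : F) (hε : σ ε * ε = 1)
    (Φ : Matrix (Fin n) (Fin n) F) (hΦ : Φᵀ = ε • Φ.map σ)
    (φ : (Fin n → F) → (Fin n → F) → F)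
    (hφ : ∀ a b, φ a b = (fun i => σ (a i)) ⬝ᵥ (Φ *ᵥ b))
    (x y : Fin n → F)
    (hxy : LinearIndependent F ![x, y])
    (X : Matrix (Fin n) (Fin n) F)
    (hX : X = vecMulVec x y - vecMulVec y x) :
    Φ.map σ * X.map σ * Φ * X = 0 ↔
      ((∀ s ∈ Submodule.span F {x, y}, ∀ t ∈ Submodule.span F {x, y}, φ s t = 0) ∨
        ∃ w ∈ Submodule.span F {x, y}, w ≠ 0 ∧ Φ *ᵥ w = 0) := by
  have hmap : X.map σ = vecMulVec (fun i => σ (x i)) (fun i => σ (y i)) -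
      vecMulVec (fun i => σ (y i)) (fun i => σ (x i)) := by
    ext i j
    simp [hX, vecMulVec_apply]
  rw [hmap, hX, mul_sub_vecMulVec_mul_mul_sub_vecMulVec,
    vecMulVec_sub_vecMulVec_eq_zero_iff hxy, map_mulVec_ringEquiv, map_mulVec_ringEquiv,
    ← hφ, ← hφ, ← hφ, ← hφ]
  have hx : x ∈ Submodule.span F {x, y} := Submodule.subset_span (by simp)
  have hy : y ∈ Submodule.span F {x, y} := Submodule.subset_span (by simp)
  have hcomb (a b : F) (s t z : Fin n → F) : φ (a • s + b • t) z = σ a * φ s z + σ b * φ t z := by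
    simp only [hφ, dotProduct, Pi.add_apply, Pi.smul_apply, smul_eq_mul, map_add, map_mul,
      Finset.mul_sum, ← Finset.sum_add_distrib]
    exact Finset.sum_congr rfl fun i _ => by ring
  have hcomb' (a b : F) (s t z : Fin n → F) : φ z (a • s + b • t) = a * φ z s + b * φ z t := by
    simp [hφ, mulVec_add, mulVec_smul, dotProduct_add]
  constructor
  · rintro ⟨h₁, h₂⟩
    have kernel (c d : F)
        (h : c • (fun i => σ ((Φ *ᵥ x) i)) - d • (fun i => σ ((Φ *ᵥ y) i)) = 0)
        (hcd : ¬(c = 0 ∧ d = 0)) :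
        ∃ w ∈ Submodule.span F {x, y}, w ≠ 0 ∧ Φ *ᵥ w = 0 := by
      refine ⟨σ c • x + -σ d • y,
        add_mem (Submodule.smul_mem _ _ hx) (Submodule.smul_mem _ _ hy), fun hw => hcd ?_, ?_⟩
      · simpa using LinearIndependent.pair_iff.1 hxy _ _ hw
      · ext i
        have := congrArg σ (congrFun h i)
        simp only [Pi.sub_apply, Pi.smul_apply, smul_eq_mul, Pi.zero_apply, map_sub, map_mul,
          map_zero, hσ] at this
        simp only [mulVec_add, mulVec_smul, Pi.add_apply, Pi.smul_apply, smul_eq_mul,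
          Pi.zero_apply]
        linear_combination this
    by_cases h₃ : φ y x = 0 ∧ φ x x = 0
    · by_cases h₄ : φ y y = 0 ∧ φ x y = 0
      · left
        intro s hs t ht
        obtain ⟨a, b, rfl⟩ := Submodule.mem_span_pair.1 hs
        obtain ⟨c, d, rfl⟩ := Submodule.mem_span_pair.1 ht
        simp [hcomb, hcomb', h₃, h₄]
      · exact Or.inr (kernel _ _ h₂ h₄)
    · exact Or.inr (kernel _ _ h₁ h₃)
  · rintro (h | ⟨w, hw, hw0, hΦw⟩)
    · simp [h x hx x hx, h x hx y hy, h y hy x hx, h y hy y hy]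
    · have hleft (z : Fin n → F) : φ w z = 0 := by
        rw [hφ, dotProduct_mulVec, ← mulVec_transpose, hΦ, smul_mulVec, map_mulVec_ringEquiv, hΦw]
        simp [dotProduct]
      obtain ⟨a, b, rfl⟩ := Submodule.mem_span_pair.1 hw
      have hab : σ a ≠ 0 ∨ σ b ≠ 0 := by
        by_contra! h
        simp only [map_eq_zero_iff σ σ.injective] at h
        exact hw0 (by simp [h])
      have huv : σ a • (fun i => σ ((Φ *ᵥ x) i)) + σ b • (fun i => σ ((Φ *ᵥ y) i)) = 0 := by
        ext i
        simpa [mulVec_add, mulVec_smul] using congrArg σ (congrFun hΦw i)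
      exact ⟨smul_sub_smul_eq_zero_of_relation hab huv (hcomb a b x y x ▸ hleft x),
        smul_sub_smul_eq_zero_of_relation hab huv (hcomb a b x y y ▸ hleft y)⟩
end

section
/- Let F be a field, n ≥ 2, and let R be an r-dimensional linear subspace of Fⁿ. Then the F-linear span of the set of matrices {u·vᵀ − v·uᵀ : u ∈ R, v ∈ Fⁿ} has dimension exactly r·(n−r) + r·(r−1)/2. -/
open Matrix

/-- The alternating product `u vᵀ - v uᵀ`, as a bilinear map. -/
def wedgeMatrix (F : Type*) [Field F] (n : ℕ) :
    (Fin n → F) →ₗ[F] (Fin n → F) →ₗ[F] Matrix (Fin n) (Fin n) F :=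
  LinearMap.mk₂ F (fun u v => vecMulVec u v - vecMulVec v u)
    (fun u u' v => by ext; simp [vecMulVec_apply]; ring)
    (fun c u v => by ext; simp [vecMulVec_apply]; ring)
    (fun u v v' => by ext; simp [vecMulVec_apply]; ring)
    (fun c u v => by ext; simp [vecMulVec_apply]; ring)

theorem wedgeMatrix_apply {F : Type*} [Field F] {n : ℕ} (u v : Fin n → F) :
    wedgeMatrix F n u v = vecMulVec u v - vecMulVec v u := rfl

theorem wedgeMatrix_self {F : Type*} [Field F] {n : ℕ} (u : Fin n → F) :
    wedgeMatrix F n u u = 0 := by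
  simp [wedgeMatrix_apply]

theorem neg_wedgeMatrix {F : Type*} [Field F] {n : ℕ} (u v : Fin n → F) :
    -wedgeMatrix F n u v = wedgeMatrix F n v u := by
  simp [wedgeMatrix_apply]

/-- Evaluation of a matrix, seen as a bilinear form on the dual space, at two linear forms. -/
def matrixEval {F : Type*} [Field F] {n : ℕ} (f g : (Fin n → F) →ₗ[F] F) :
    Matrix (Fin n) (Fin n) F →ₗ[F] F where
  toFun A := f (fun a => g (A a))
  map_add' A B := by
    rw [← map_add]
    congr 1
    funext a
    exact map_add g (A a) (B a)
  map_smul' c A := by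
    rw [RingHom.id_apply, ← map_smul]
    congr 1
    funext a
    exact map_smul g c (A a)

theorem matrixEval_vecMulVec {F : Type*} [Field F] {n : ℕ} (f g : (Fin n → F) →ₗ[F] F)
    (u v : Fin n → F) : matrixEval f g (vecMulVec u v) = f u * g v := by
  have h : (fun a => g (vecMulVec u v a)) = g v • u := by
    funext a
    have : vecMulVec u v a = u a • v := rfl
    rw [this, map_smul, Pi.smul_apply, smul_eq_mul, smul_eq_mul, mul_comm]
  change f (fun a => g (vecMulVec u v a)) = _
  rw [h, map_smul, smul_eq_mul, mul_comm]

/-- A subspace of `Fⁿ` has a basis that extends to `Fⁿ` by vectors placed before it. -/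
theorem exists_basis_natAdd {F : Type*} [Field F] {n : ℕ} (R : Submodule F (Fin n → F)) {r : ℕ}
    (hr : Module.finrank F R = r) :
    ∃ s : ℕ, s + r = n ∧ ∃ b : Module.Basis (Fin (s + r)) F (Fin n → F),
      Submodule.span F (Set.range fun i : Fin r => b (Fin.natAdd s i)) = R := by
  obtain ⟨R', h⟩ := R.exists_isCompl
  have hs := Submodule.finrank_add_eq_of_isCompl h
  rw [hr, Module.finrank_fin_fun] at hs
  let c := Module.finBasisOfFinrankEq F R hr
  refine ⟨Module.finrank F R', by omega,
    (((Module.finBasis F R').prod c).map (Submodule.prodEquivOfIsCompl R' R h.symm)).reindex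
      finSumFinEquiv, ?_⟩
  have hc : (fun i : Fin r => ((((Module.finBasis F R').prod c).map
      (Submodule.prodEquivOfIsCompl R' R h.symm)).reindex finSumFinEquiv)
        (Fin.natAdd (Module.finrank F R') i)) = R.subtype ∘ c := by
    funext i
    simp
  rw [hc, Set.range_comp, ← Submodule.map_span, c.span_eq, Submodule.map_top,
    Submodule.range_subtype]

/-- The products `bᵢ ∧ bⱼ` with `j < i` and `bᵢ` among the last `r` basis vectors. -/
noncomputable def basisWedge {F : Type*} [Field F] {n s r : ℕ}
    (b : Module.Basis (Fin (s + r)) F (Fin n → F)) (p : Σ i : Fin r, Fin (s + i)) :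
    Matrix (Fin n) (Fin n) F :=
  wedgeMatrix F n (b (Fin.natAdd s p.1)) (b (Fin.castLE (by omega) p.2))

theorem linearIndependent_basisWedge {F : Type*} [Field F] {n s r : ℕ}
    (b : Module.Basis (Fin (s + r)) F (Fin n → F)) : LinearIndependent F (basisWedge b) := by
  let T : Matrix (Fin n) (Fin n) F →ₗ[F] ((Σ i : Fin r, Fin (s + i)) → F) :=
    LinearMap.pi fun p => matrixEval (b.coord (Fin.natAdd s p.1))
      (b.coord (Fin.castLE (by omega) p.2))
  apply LinearIndependent.of_comp T
  have h : T ∘ basisWedge b = fun p => Pi.single p 1 := by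
    funext ⟨i, j⟩ ⟨k, l⟩
    simp only [T, Function.comp_apply, LinearMap.pi_apply, basisWedge, wedgeMatrix_apply, map_sub,
      matrixEval_vecMulVec, Module.Basis.coord_apply, Module.Basis.repr_self,
      Finsupp.single_apply, Pi.single_apply]
    have hj := j.isLt
    have hl := l.isLt
    by_cases hik : i = k
    · subst hik
      simp [Fin.ext_iff, eq_comm]
      simp [hl.ne]
    · have hki : ¬ k = i := fun h => hik h.symm
      have hne : ¬ (i : ℕ) = k := fun h => hik (Fin.ext h)
      simp [Fin.ext_iff, hne, hki]
      omega
  rw [h]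
  exact Pi.linearIndependent_single_one _ F

theorem span_range_basisWedge {F : Type*} [Field F] {n s r : ℕ}
    (b : Module.Basis (Fin (s + r)) F (Fin n → F)) (R : Submodule F (Fin n → F))
    (hR : Submodule.span F (Set.range fun i : Fin r => b (Fin.natAdd s i)) = R) :
    Submodule.span F (Set.range (basisWedge b)) =
      Submodule.span F {A : Matrix (Fin n) (Fin n) F | ∃ u ∈ R, ∃ v : Fin n → F,
        A = vecMulVec u v - vecMulVec v u} := by
  apply le_antisymm
  · apply Submodule.span_mono
    rintro _ ⟨p, rfl⟩
    exact ⟨_, hR ▸ Submodule.subset_span ⟨p.1, rfl⟩, _, rfl⟩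
  · rw [Submodule.span_le]
    rintro _ ⟨u, hu, v, rfl⟩
    have hmem (i : Fin r) (k : Fin (s + r)) (h : (k : ℕ) < s + i) :
        wedgeMatrix F n (b (Fin.natAdd s i)) (b k) ∈
          Submodule.span F (Set.range (basisWedge b)) :=
      Submodule.subset_span ⟨⟨i, k, h⟩, rfl⟩
    have hbasis (i : Fin r) (k : Fin (s + r)) :
        wedgeMatrix F n (b (Fin.natAdd s i)) (b k) ∈
          Submodule.span F (Set.range (basisWedge b)) := by
      rcases lt_trichotomy (k : ℕ) (s + i) with h | h | h
      · exact hmem i k h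
      · rw [show k = Fin.natAdd s i from Fin.ext h, wedgeMatrix_self]
        exact zero_mem _
      · obtain ⟨k', rfl⟩ : ∃ k' : Fin r, k = Fin.natAdd s k' :=
          ⟨⟨k - s, by omega⟩, Fin.ext (by simp; omega)⟩
        rw [← neg_wedgeMatrix]
        exact neg_mem (hmem k' _ (by simpa using h))
    have hleft (i : Fin r) :
        wedgeMatrix F n (b (Fin.natAdd s i)) v ∈ Submodule.span F (Set.range (basisWedge b)) := by
      have hv : v ∈ Submodule.span F (Set.range b) := b.mem_span v
      refine (Submodule.span_le (p := (Submodule.span F (Set.range (basisWedge b))).comap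
        (wedgeMatrix F n (b (Fin.natAdd s i))))).2 ?_ hv
      rintro _ ⟨k, rfl⟩
      exact hbasis i k
    rw [← hR] at hu
    refine (Submodule.span_le (p := (Submodule.span F (Set.range (basisWedge b))).comap
      ((wedgeMatrix F n).flip v))).2 ?_ hu
    rintro _ ⟨i, rfl⟩
    exact hleft i



/-- Subsection 3.4: for an `r`-dimensional subspace `R` of `Fⁿ`, the span of
the matrices `uvᵀ − vuᵀ` with `u ∈ R`, `v ∈ Fⁿ` (the image of `R ∧ Fⁿ`) has
dimension `r(n−r) + r(r−1)/2`. -/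
theorem stmt_13 (F : Type*) [Field F] (n : ℕ) (hn : 2 ≤ n)
    (R : Submodule F (Fin n → F)) (r : ℕ) (hr : Module.finrank F R = r) :
    Module.finrank F (Submodule.span F
      {A : Matrix (Fin n) (Fin n) F | ∃ u ∈ R, ∃ v : Fin n → F,
        A = vecMulVec u v - vecMulVec v u}) =
      r * (n - r) + r * (r - 1) / 2 := by
  obtain ⟨s, rfl, b, hb⟩ := exists_basis_natAdd R hr
  rw [← span_range_basisWedge b R hb, finrank_span_eq_card (linearIndependent_basisWedge b),
    Fintype.card_sigma]
  simp only [Fintype.card_fin]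
  rw [Fin.sum_univ_eq_sum_range (fun i => s + i), Finset.sum_add_distrib, Finset.sum_range_id]
  simp
end
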